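/- Let N⁺ = {((1, x; 0, 1), 0) : x ∈ ℝ} ⊂ G and V_0 = {(I,(t,0)) : t ∈ ℝ} ⊂ G. Let v_n = (α_n, β_n) ∈ ℝ² with |β_n| → ∞. Then (I,v_n) N⁺ (I,v_n)⁻¹ → V_0 in the Chabauty sense. -/

import Mathlib

open Matrix Filter Topology

/-- `SL2` is the special linear group `SL(2,ℝ)`. -/
abbrev SL2 : Type := Matrix.SpecialLinearGroup (Fin 2) ℝ

/-- `M2` is the space of 2×2 real matrices. -/
abbrev M2 : Type := Matrix (Fin 2) (Fin 2) ℝ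

noncomputable instance : TopologicalSpace SL2 :=
  TopologicalSpace.induced (fun g => (g : M2)) inferInstance

/-- Chabauty-sense convergence of a sequence of subsets of a topological space `X`:
(i) every point of the limit is a limit of a sequence of points of the `H n`;
(ii) every convergent sequence `x (k n) ∈ H (k n)` along a strictly increasing sequence
of indices has its limit in `L`. -/
def ChabautyTendsto {X : Type*} [TopologicalSpace X] (H : ℕ → Set X) (L : Set X) : Prop :=
  (∀ h ∈ L, ∃ u : ℕ → X, (∀ n, u n ∈ H n) ∧ Filter.Tendsto u Filter.atTop (nhds h)) ∧
  (∀ k : ℕ → ℕ, StrictMono k → ∀ x : ℕ → X, (∀ n, x n ∈ H (k n)) →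
    ∀ l : X, Filter.Tendsto x Filter.atTop (nhds l) → l ∈ L)

/-- Conjugate `x S x⁻¹` of a subset `S` of a group by a group element `x`. -/
def conjSet {X : Type*} [Group X] (x : X) (S : Set X) : Set X :=
  (fun s => x * s * x⁻¹) '' S

/-- The group `G = SL(2,ℝ) ⋉ ℝ²`: elements are pairs `(g, v)`. -/
structure GSL : Type where
  g : SL2
  v : Fin 2 → ℝ

namespace GSL

noncomputable instance : TopologicalSpace GSL :=
  TopologicalSpace.induced (fun p => (p.g, p.v)) inferInstance

/-- Multiplication `(g,v)(g',v') = (gg', v + g·v')`. -/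
noncomputable instance : Mul GSL :=
  ⟨fun p q => ⟨p.g * q.g, p.v + (p.g : M2) *ᵥ q.v⟩⟩

noncomputable instance : One GSL := ⟨⟨1, 0⟩⟩

noncomputable instance : Inv GSL :=
  ⟨fun p => ⟨p.g⁻¹, -((↑(p.g⁻¹) : M2) *ᵥ p.v)⟩⟩

@[simp] lemma mul_def (p q : GSL) :
    p * q = ⟨p.g * q.g, p.v + (p.g : M2) *ᵥ q.v⟩ := rfl

@[simp] lemma one_def : (1 : GSL) = ⟨1, 0⟩ := rfl

@[simp] lemma inv_def (p : GSL) :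
    p⁻¹ = ⟨p.g⁻¹, -((↑(p.g⁻¹) : M2) *ᵥ p.v)⟩ := rfl

noncomputable instance : Group GSL where
  mul_assoc a b c := by
    simp only [mul_def, GSL.mk.injEq]
    refine ⟨mul_assoc _ _ _, ?_⟩
    simp only [Matrix.SpecialLinearGroup.coe_mul, Matrix.mulVec_add, Matrix.mulVec_mulVec, add_assoc]
  one_mul a := by
    simp only [one_def, mul_def, GSL.mk.injEq]
    simp
  mul_one a := by
    simp only [one_def, mul_def, GSL.mk.injEq]
    simp
  inv_mul_cancel a := by
    simp only [inv_def, mul_def, one_def, GSL.mk.injEq]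
    exact ⟨inv_mul_cancel _, neg_add_cancel _⟩

end GSL

/-- The unipotent matrix `(1, s; 0, 1)` as an element of `SL(2,ℝ)`. -/
noncomputable def sMat (s : ℝ) : SL2 :=
  ⟨!![1, s; 0, 1], by simp [Matrix.det_fin_two_of]⟩

/-- The diagonal matrix `diag(a, 1/a)` as an element of `SL(2,ℝ)` (for `a ≠ 0`). -/
noncomputable def aMat (a : ℝ) (ha : a ≠ 0) : SL2 :=
  ⟨!![a, 0; 0, a⁻¹], by simp [Matrix.det_fin_two_of, mul_inv_cancel₀ ha]⟩

/-- The unipotent subgroup `N⁺ = {((1, x; 0, 1), 0) : x ∈ ℝ}` of `G`. -/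
def NplusSet : Set GSL := {p | (∃ x : ℝ, (p.g : M2) = !![1, x; 0, 1]) ∧ p.v = 0}

/-- The subgroup `V_c = {(I, (t, c t)) : t ∈ ℝ}` of `G`. -/
def Vc (c : ℝ) : Set GSL := {p | p.g = 1 ∧ ∃ t : ℝ, p.v = ![t, c * t]}

lemma GSL.tendsto_iff (u : ℕ → GSL) (h : GSL) :
    Tendsto u atTop (𝓝 h) ↔
      (∀ i j, Tendsto (fun n => ((u n).g : M2) i j) atTop (𝓝 ((h.g : M2) i j))) ∧
      (∀ i, Tendsto (fun n => (u n).v i) atTop (𝓝 (h.v i))) := by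
  have h1 : IsInducing (fun p : GSL => (p.g, p.v)) := ⟨rfl⟩
  have h2 : IsInducing (fun g : SL2 => (g : M2)) := ⟨rfl⟩
  rw [h1.tendsto_nhds_iff, Prod.tendsto_iff, h2.tendsto_nhds_iff]
  refine and_congr ?_ tendsto_pi_nhds
  refine Iff.trans tendsto_pi_nhds (forall_congr' fun i => tendsto_pi_nhds)

lemma mem_conj_iff (a b : ℝ) (p : GSL) :
    p ∈ conjSet (⟨1, ![a, b]⟩ : GSL) NplusSet ↔
      ∃ x : ℝ, (p.g : M2) = !![1, x; 0, 1] ∧ p.v = ![-(x * b), 0] := by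
  have key : ∀ (g : SL2) (x : ℝ), (g : M2) = !![1, x; 0, 1] →
      (⟨1, ![a, b]⟩ : GSL) * ⟨g, 0⟩ * (⟨1, ![a, b]⟩ : GSL)⁻¹ = ⟨g, ![-(x * b), 0]⟩ := by
    intro g x hg
    simp only [GSL.mul_def, GSL.inv_def, GSL.mk.injEq]
    refine ⟨by simp, ?_⟩
    ext i
    fin_cases i <;> simp [hg, mul_comm]
  constructor
  · rintro ⟨⟨g, v⟩, ⟨⟨x, hx⟩, hv⟩, rfl⟩
    simp only at hx hv
    subst hv
    refine ⟨x, ?_⟩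
    beta_reduce
    rw [key g x hx]
    exact ⟨hx, rfl⟩
  · obtain ⟨g, v⟩ := p
    rintro ⟨x, hx, hv⟩
    simp only at hx hv
    subst hv
    exact ⟨⟨g, 0⟩, ⟨⟨x, hx⟩, rfl⟩, key g x hx⟩

/-- If `vₙ = (αₙ, βₙ)` with `|βₙ| → ∞`, then `(I,vₙ) N⁺ (I,vₙ)⁻¹ → V₀`
in the Chabauty sense. -/
theorem unipotent_conj_tendsto_V0 (α β : ℕ → ℝ)
    (hβ : Tendsto (fun n => |β n|) atTop atTop) :
    ChabautyTendsto (fun n => conjSet (⟨1, ![α n, β n]⟩ : GSL) NplusSet) (Vc 0) := by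
  constructor
  · rintro ⟨g, v⟩ ⟨hg, t, hv⟩
    simp only at hg hv
    subst hg hv
    have hinv : Tendsto (fun n => (β n)⁻¹) atTop (𝓝 0) := by
      rw [tendsto_zero_iff_abs_tendsto_zero]
      refine hβ.inv_tendsto_atTop.congr fun n => ?_
      simp [abs_inv]
    have hx : Tendsto (fun n => -t * (β n)⁻¹) atTop (𝓝 0) := by
      simpa using hinv.const_mul (-t)
    refine ⟨fun n => ⟨sMat (-t * (β n)⁻¹), ![-((-t * (β n)⁻¹) * β n), 0]⟩,
      fun n => (mem_conj_iff _ _ _).2 ⟨_, rfl, rfl⟩, ?_⟩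
    rw [GSL.tendsto_iff]
    constructor
    · intro i j
      fin_cases i <;> fin_cases j <;> simp [sMat]
      simpa using hx
    · intro i
      fin_cases i
      · refine tendsto_const_nhds.congr' ?_
        filter_upwards [hβ.eventually_gt_atTop 0] with n hn
        have : β n ≠ 0 := abs_pos.1 hn
        simp [this]
      · simp
  · intro k hk x hx l hl
    rw [GSL.tendsto_iff] at hl
    obtain ⟨hm, hv⟩ := hl
    choose s hs hw using fun n => (mem_conj_iff _ _ _).1 (hx n)
    simp only [hs, hw] at hm hv
    have h00 := tendsto_nhds_unique (hm 0 0) (by simp : Tendsto _ atTop (𝓝 (1 : ℝ)))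
    have h10 := tendsto_nhds_unique (hm 1 0) (by simp : Tendsto _ atTop (𝓝 (0 : ℝ)))
    have h11 := tendsto_nhds_unique (hm 1 1) (by simp : Tendsto _ atTop (𝓝 (1 : ℝ)))
    have hv1 := tendsto_nhds_unique (hv 1) (by simp : Tendsto _ atTop (𝓝 (0 : ℝ)))
    have hβk : Tendsto (fun n => |β (k n)|) atTop atTop := hβ.comp hk.tendsto_atTop
    have hinv : Tendsto (fun n => (β (k n))⁻¹) atTop (𝓝 0) := by
      rw [tendsto_zero_iff_abs_tendsto_zero]
      refine hβk.inv_tendsto_atTop.congr fun n => ?_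
      simp [abs_inv]
    have hs0 : Tendsto s atTop (𝓝 0) := by
      have h := ((hv 0).mul hinv).neg
      simp only [mul_zero, neg_zero] at h
      refine h.congr' ?_
      filter_upwards [hβk.eventually_gt_atTop 0] with n hn
      have : β (k n) ≠ 0 := abs_pos.1 hn
      simp [this]
    have h01 := tendsto_nhds_unique (hm 0 1) (by simpa using hs0 : Tendsto _ atTop (𝓝 (0 : ℝ)))
    refine ⟨?_, l.v 0, ?_⟩
    · ext i j
      fin_cases i <;> fin_cases j <;> simp [h00, h01, h10, h11]
    · ext i
      fin_cases i <;> simp [hv1]
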